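/- Suppose ν(ℓ = m) > 0, where m = essInf ℓ. Then the second derivative of J tends to 0 as λ → ∞; equivalently, the variance of ℓ under the exponentially tilted measure with density exp(−λ·ℓ)/∫exp(−λ·ℓ)dν converges to 0 as λ → ∞. -/

import Mathlib

open MeasureTheory Filter Topology

/-- Laplace asymptotics at the essential infimum: only the mass on `{ℓ = m}` survives. -/
theorem tendsto_integral_pow_mul_exp
    {Ω : Type*} [MeasurableSpace Ω] {ν : Measure Ω} [IsFiniteMeasure ν]
    {ℓ : Ω → ℝ} (hmeas : Measurable ℓ) {C m : ℝ}
    (hbound : ∀ᵐ ω ∂ν, |ℓ ω| ≤ C) (hm : ∀ᵐ ω ∂ν, m ≤ ℓ ω) (n : ℕ) :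
    Tendsto (fun lam : ℝ => Real.exp (lam * m) * ∫ ω, ℓ ω ^ n * Real.exp (-lam * ℓ ω) ∂ν)
      atTop (𝓝 (m ^ n * ν.real {ω | ℓ ω = m})) := by
  have hset : MeasurableSet {ω | ℓ ω = m} := measurableSet_eq_fun hmeas measurable_const
  have hlim : m ^ n * ν.real {ω | ℓ ω = m} =
      ∫ ω, Set.indicator {ω | ℓ ω = m} (fun _ => m ^ n) ω ∂ν := by
    rw [integral_indicator_const _ hset, smul_eq_mul, mul_comm]
  have hfun : ∀ lam : ℝ, Real.exp (lam * m) * ∫ ω, ℓ ω ^ n * Real.exp (-lam * ℓ ω) ∂ν =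
      ∫ ω, ℓ ω ^ n * Real.exp (-(lam * (ℓ ω - m))) ∂ν := fun lam => by
    rw [← integral_const_mul]
    refine integral_congr_ae (.of_forall fun ω => ?_)
    simp only
    rw [mul_left_comm, ← Real.exp_add]
    ring_nf
  simp_rw [hfun, hlim]
  refine tendsto_integral_filter_of_dominated_convergence (fun _ => C ^ n)
    (.of_forall fun lam => by fun_prop) ?_ (integrable_const _) ?_
  · filter_upwards [eventually_ge_atTop 0] with lam hlam
    filter_upwards [hbound, hm] with ω hC hmω
    have hexp : Real.exp (-(lam * (ℓ ω - m))) ≤ 1 :=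
      Real.exp_le_one_iff.2 (neg_nonpos.2 (mul_nonneg hlam (sub_nonneg.2 hmω)))
    rw [norm_mul, norm_pow, Real.norm_eq_abs, Real.norm_eq_abs, Real.abs_exp]
    calc |ℓ ω| ^ n * Real.exp (-(lam * (ℓ ω - m))) ≤ |ℓ ω| ^ n * 1 := by gcongr
      _ ≤ C ^ n := by rw [mul_one]; gcongr
  · filter_upwards [hm] with ω hmω
    rcases hmω.eq_or_lt with h | h
    · simp [← h]
    · have hexp : Tendsto (fun lam : ℝ => Real.exp (-(lam * (ℓ ω - m)))) atTop (𝓝 0) :=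
        Real.tendsto_exp_neg_atTop_nhds_zero.comp
          (tendsto_id.atTop_mul_const (sub_pos.2 h))
      simpa [h.ne'] using hexp.const_mul (ℓ ω ^ n)

/-- If `ν(ℓ = m) > 0` where `m = essInf ℓ`, then the second derivative of the Jensen-gap
function `J` tends to `0` as `λ → ∞`; equivalently, the variance of `ℓ` under the
exponentially tilted measure with density `exp(−λℓ)/∫exp(−λℓ)dν` tends to `0`. -/
theorem jensen_gap_second_deriv_tendsto_zero
    {Ω : Type*} [MeasurableSpace Ω] (ν : Measure Ω) [IsProbabilityMeasure ν]
    (ℓ : Ω → ℝ) (hmeas : Measurable ℓ)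
    (C : ℝ) (hC : 0 < C) (hbound : ∀ᵐ ω ∂ν, 0 ≤ ℓ ω ∧ ℓ ω ≤ C)
    (J : ℝ → ℝ)
    (hJ : ∀ lam : ℝ,
      J lam = Real.log (∫ ω, Real.exp (-lam * ℓ ω) ∂ν) + lam * ∫ ω, ℓ ω ∂ν)
    (m : ℝ) (hm : m = essInf ℓ ν)
    (hmass : 0 < ν {ω | ℓ ω = m}) :
    Tendsto (fun lam => deriv (deriv J) lam) atTop (𝓝 0) ∧
    Tendsto (fun lam =>
        (∫ ω, (ℓ ω) ^ 2 * Real.exp (-lam * ℓ ω) ∂ν) / (∫ ω, Real.exp (-lam * ℓ ω) ∂ν) -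
          ((∫ ω, ℓ ω * Real.exp (-lam * ℓ ω) ∂ν) / (∫ ω, Real.exp (-lam * ℓ ω) ∂ν)) ^ 2)
      atTop (𝓝 0) := by
  have habs : ∀ᵐ ω ∂ν, |ℓ ω| ≤ C := by
    filter_upwards [hbound] with ω h using (abs_of_nonneg h.1).trans_le h.2
  have hle : ∀ᵐ ω ∂ν, m ≤ ℓ ω :=
    hm ▸ ae_essInf_le ⟨0, hbound.mono fun ω h => h.1⟩
  have hpos : ν.real {ω | ℓ ω = m} ≠ 0 :=
    (ENNReal.toReal_pos hmass.ne' (measure_ne_top _ _)).ne'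
  have hvar : Tendsto (fun lam : ℝ =>
        (∫ ω, (ℓ ω) ^ 2 * Real.exp (-lam * ℓ ω) ∂ν) / (∫ ω, Real.exp (-lam * ℓ ω) ∂ν) -
          ((∫ ω, ℓ ω * Real.exp (-lam * ℓ ω) ∂ν) / (∫ ω, Real.exp (-lam * ℓ ω) ∂ν)) ^ 2)
      atTop (𝓝 0) := by
    have hlim := tendsto_integral_pow_mul_exp hmeas habs hle
    have h := ((hlim 2).div (hlim 0) (by simpa using hpos)).sub
      (((hlim 1).div (hlim 0) (by simpa using hpos)).pow 2)
    simpa [mul_div_mul_left, hpos] using h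
  refine ⟨hvar.congr fun lam => ?_, hvar⟩
  have hint : ∀ t, t ∈ interior (ProbabilityTheory.integrableExpSet ℓ ν) := fun t => by
    have : ProbabilityTheory.integrableExpSet ℓ ν = Set.univ :=
      Set.eq_univ_of_forall fun s =>
        ProbabilityTheory.integrable_exp_mul_of_mem_Icc hmeas.aemeasurable hbound
    simp [this]
  have hJ' : J = fun lam => ProbabilityTheory.cgf ℓ ν (-lam) + lam * ∫ ω, ℓ ω ∂ν := funext hJ
  have hderiv : deriv J =
      fun lam => -deriv (ProbabilityTheory.cgf ℓ ν) (-lam) + ∫ ω, ℓ ω ∂ν := by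
    ext t
    have hd : DifferentiableAt ℝ (fun s => ProbabilityTheory.cgf ℓ ν (-s)) t :=
      (ProbabilityTheory.analyticAt_cgf (hint (-t))).differentiableAt.comp t
        differentiableAt_id.neg
    rw [hJ', deriv_fun_add hd (by fun_prop), deriv_comp_neg]
    simp
  rw [hderiv, deriv_add_const, deriv.fun_neg, deriv_comp_neg, neg_neg]
  have h2 := ProbabilityTheory.iteratedDeriv_two_cgf (hint (-lam))
  rw [iteratedDeriv_succ, iteratedDeriv_one, ProbabilityTheory.deriv_cgf (hint (-lam))] at h2
  exact h2.symm
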